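/- arXiv:1408.3187 — 6 statements merged into one kernel-verified Lean document; each statement's English description precedes it below -/
import Mathlib

section
/- For every μ > 0 and ξ ∈ ℝ^N, the function w_{μ,ξ} is invariant under the Kelvin transform — i.e. |y|^{2s−N} w_{μ,ξ}(y/|y|²) = w_{μ,ξ}(y) for all y ≠ 0 — if and only if μ² + |ξ|² = 1. -/
open Real

noncomputable section

/-- The standard bubble `U(y) = c (1/(1+|y|²))^{(N-2s)/2}`. -/
def bubble (N : ℕ) (s c : ℝ) (y : EuclideanSpace ℝ (Fin N)) : ℝ :=
  c * (1 / (1 + ‖y‖ ^ 2)) ^ (((N : ℝ) - 2 * s) / 2)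

/-- Rescaled, translated bubble `w_{μ,ξ}(y) = μ^{-(N-2s)/2} U((y-ξ)/μ)`. -/
def wBubble (N : ℕ) (s c μ : ℝ) (ξ y : EuclideanSpace ℝ (Fin N)) : ℝ :=
  μ ^ (-(((N : ℝ) - 2 * s) / 2)) * bubble N s c (μ⁻¹ • (y - ξ))

/-- The rescaled bubble in closed form, with the power of the scale absorbed. -/
theorem wBubble_eq (N : ℕ) (s c : ℝ) {μ : ℝ} (hμ : 0 < μ) (ξ y : EuclideanSpace ℝ (Fin N)) :
    wBubble N s c μ ξ y =
      c * (μ / (μ ^ 2 + ‖y - ξ‖ ^ 2)) ^ (((N : ℝ) - 2 * s) / 2) := by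
  unfold wBubble bubble
  rw [mul_left_comm, rpow_neg hμ.le, ← inv_rpow hμ.le,
    ← mul_rpow (by positivity) (by positivity), norm_smul, norm_inv, norm_of_nonneg hμ.le]
  congr 2
  field_simp

/-- The Kelvin transform of the rescaled bubble in closed form. -/
theorem kelvin_wBubble_eq (N : ℕ) (s c : ℝ) {μ : ℝ} (hμ : 0 < μ)
    (ξ : EuclideanSpace ℝ (Fin N)) {y : EuclideanSpace ℝ (Fin N)} (hy : y ≠ 0) :
    ‖y‖ ^ (2 * s - (N : ℝ)) * wBubble N s c μ ξ ((‖y‖ ^ 2)⁻¹ • y) =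
      c * (μ / (‖y‖ ^ 2 * (μ ^ 2 + ‖(‖y‖ ^ 2)⁻¹ • y - ξ‖ ^ 2))) ^ (((N : ℝ) - 2 * s) / 2) := by
  have hy' : 0 < ‖y‖ := norm_pos_iff.mpr hy
  have hpow : ‖y‖ ^ (2 * s - (N : ℝ)) = ((‖y‖ ^ 2)⁻¹) ^ (((N : ℝ) - 2 * s) / 2) := by
    rw [inv_rpow (by positivity), ← rpow_natCast, ← rpow_mul hy'.le, ← rpow_neg hy'.le]
    congr 1
    push_cast
    ring
  rw [wBubble_eq N s c hμ, hpow, mul_left_comm, ← mul_rpow (by positivity) (by positivity)]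
  congr 2
  field_simp

/-- The difference of the two denominators factors through `‖y‖ ^ 2 - 1`. -/
theorem kelvin_denom_sub (N : ℕ) (μ : ℝ) (ξ : EuclideanSpace ℝ (Fin N))
    {y : EuclideanSpace ℝ (Fin N)} (hy : y ≠ 0) :
    ‖y‖ ^ 2 * (μ ^ 2 + ‖(‖y‖ ^ 2)⁻¹ • y - ξ‖ ^ 2) - (μ ^ 2 + ‖y - ξ‖ ^ 2) =
      (μ ^ 2 + ‖ξ‖ ^ 2 - 1) * (‖y‖ ^ 2 - 1) := by
  have hy' : ‖y‖ ≠ 0 := norm_ne_zero_iff.mpr hy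
  rw [norm_sub_sq_real, norm_sub_sq_real, real_inner_smul_left, norm_smul, norm_inv, norm_pow,
    norm_norm]
  field_simp
  ring

/-- `w_{μ,ξ}` is invariant under the Kelvin transform
`u ↦ |y|^{2s-N} u(y/|y|²)` iff `μ² + |ξ|² = 1`. -/
theorem wBubble_kelvin_invariant_iff
    (N : ℕ) (hN : 3 ≤ N) (s : ℝ) (hs : s ∈ Set.Ioo (0 : ℝ) 1) (c : ℝ) (hc : 0 < c)
    (μ : ℝ) (hμ : 0 < μ) (ξ : EuclideanSpace ℝ (Fin N)) :
    (∀ y : EuclideanSpace ℝ (Fin N), y ≠ 0 →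
      ‖y‖ ^ (2 * s - (N : ℝ)) * wBubble N s c μ ξ ((‖y‖ ^ 2)⁻¹ • y) = wBubble N s c μ ξ y) ↔
    μ ^ 2 + ‖ξ‖ ^ 2 = 1 := by
  have hp : 0 < ((N : ℝ) - 2 * s) / 2 := by
    have : (3 : ℝ) ≤ N := by exact_mod_cast hN
    linarith [hs.2]
  have key : ∀ y : EuclideanSpace ℝ (Fin N), y ≠ 0 →
      (‖y‖ ^ (2 * s - (N : ℝ)) * wBubble N s c μ ξ ((‖y‖ ^ 2)⁻¹ • y) = wBubble N s c μ ξ y ↔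
        (μ ^ 2 + ‖ξ‖ ^ 2 - 1) * (‖y‖ ^ 2 - 1) = 0) := by
    intro y hy
    have hy' : 0 < ‖y‖ := norm_pos_iff.mpr hy
    rw [kelvin_wBubble_eq N s c hμ ξ hy, wBubble_eq N s c hμ, mul_right_inj' hc.ne',
      rpow_left_inj (by positivity) (by positivity) hp.ne',
      div_eq_mul_inv, div_eq_mul_inv, mul_right_inj' hμ.ne', inv_inj,
      ← kelvin_denom_sub N μ ξ hy, sub_eq_zero]
  constructor
  · intro h
    have hnorm : ‖EuclideanSpace.single (⟨0, by lia⟩ : Fin N) (2 : ℝ)‖ = 2 := by simp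
    have hne : EuclideanSpace.single (⟨0, by lia⟩ : Fin N) (2 : ℝ) ≠ 0 := by
      rw [← norm_ne_zero_iff, hnorm]
      norm_num
    have h2 := (key _ hne).mp (h _ hne)
    rw [hnorm] at h2
    linarith
  · intro h y hy
    rw [key y hy, h, sub_self, zero_mul]

end
end

section
/- Fix δ > 0 and η ∈ (0,1). There exist an integer k₀ and a constant C > 0 such that for every k ≥ k₀ and every y in the exterior region EX = {y ∈ ℝ^N : |y − ξ_j| > η/k for all j = 1,…,k}, the error function satisfies |E(y)| ≤ C μ^{(N−2s)/2} (1+|y|²)^{−2s} Σ_{j=1}^k |y−ξ_j|^{−(N−2s)}. -/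
open MeasureTheory Real Finset ENNReal

noncomputable section

/-- The critical exponent `p = (N+2s)/(N-2s)`. -/
def pExp (N : ℕ) (s : ℝ) : ℝ := ((N : ℝ) + 2 * s) / ((N : ℝ) - 2 * s)

/-- The concentration parameter `μ = δ^{2/(N-2s)} k^{-3}`. -/
def muK (N : ℕ) (s δ : ℝ) (k : ℕ) : ℝ := δ ^ (2 / ((N : ℝ) - 2 * s)) * (k : ℝ) ^ (-3 : ℝ)

/-- The point `r (cos θ, sin θ, 0, …, 0)` of `ℝ^N = ℝ² × ℝ^{N-2}`. -/
def circPt (N : ℕ) (r θ : ℝ) : EuclideanSpace ℝ (Fin N) :=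
  (EuclideanSpace.equiv (Fin N) ℝ).symm
    (fun i => if (i : ℕ) = 0 then r * Real.cos θ
      else if (i : ℕ) = 1 then r * Real.sin θ else 0)

/-- The concentration points `ξ_j = √(1-μ²) (cos(2π(j-1)/k), sin(2π(j-1)/k), 0, …, 0)`. -/
def xiPt (N : ℕ) (μ : ℝ) (k j : ℕ) : EuclideanSpace ℝ (Fin N) :=
  circPt N (Real.sqrt (1 - μ ^ 2)) (2 * Real.pi * ((j : ℝ) - 1) / k)

/-- The ansatz `U_* = U - ∑_{j=1}^k U_j`, where `U_j = w_{μ,ξ_j}`. -/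
def Ustar (N : ℕ) (s c δ : ℝ) (k : ℕ) (y : EuclideanSpace ℝ (Fin N)) : ℝ :=
  bubble N s c y -
    ∑ j ∈ Finset.Icc 1 k, wBubble N s c (muK N s δ k) (xiPt N (muK N s δ k) k j) y

/-- The error function `E = U^p - ∑_j U_j^p - |U_*|^{p-1} U_*`. -/
def errFun (N : ℕ) (s c δ : ℝ) (k : ℕ) (y : EuclideanSpace ℝ (Fin N)) : ℝ :=
  bubble N s c y ^ pExp N s -
    ∑ j ∈ Finset.Icc 1 k,
      wBubble N s c (muK N s δ k) (xiPt N (muK N s δ k) k j) y ^ pExp N s -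
    |Ustar N s c δ k y| ^ (pExp N s - 1) * Ustar N s c δ k y

/-- The weighted norm `‖h‖_** = (∫ (1+|y|)^{(N+2s)q-2N} |h|^q)^{1/q}`, valued in `ℝ≥0∞`. -/
def starstarNorm (N : ℕ) (s q : ℝ) (h : EuclideanSpace ℝ (Fin N) → ℝ) : ℝ≥0∞ :=
  (∫⁻ y : EuclideanSpace ℝ (Fin N),
    ENNReal.ofReal ((1 + ‖y‖) ^ (((N : ℝ) + 2 * s) * q - 2 * N) * |h y| ^ q)) ^ (1 / q)

/-- A Bernoulli-type bound for the increment of `t ↦ |t|^{p-1} t`. -/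
lemma abs_rpow_sub_signed_rpow_le {u S K p : ℝ} (hu : 0 < u) (hS : 0 ≤ S) (hSK : S ≤ K * u)
    (hK : 0 ≤ K) (hp : 1 < p) :
    |u ^ p - |u - S| ^ (p - 1) * (u - S)| ≤ (p + K ^ (p - 1)) * u ^ (p - 1) * S := by
  have hup : u ^ p = u ^ (p - 1) * u := by
    rw [← Real.rpow_add_one hu.ne']; ring_nf
  have hu1 : 0 ≤ u ^ (p - 1) := by positivity
  have hK1 : 0 ≤ K ^ (p - 1) := by positivity
  have hKuS : 0 ≤ K ^ (p - 1) * u ^ (p - 1) * S := by positivity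
  rcases le_or_gt S u with h | h
  · have h0 : 0 ≤ u - S := by linarith
    have e : |u - S| ^ (p - 1) * (u - S) = (u - S) ^ p := by
      rw [abs_of_nonneg h0]
      rw [← Real.rpow_add_one' h0 (by linarith)]; ring_nf
    have hb := one_add_mul_self_le_rpow_one_add (s := -(S / u)) (p := p)
      (by rw [neg_le_neg_iff, div_le_one hu]; exact h) hp.le
    have e2 : (u - S) ^ p = u ^ p * (1 + -(S / u)) ^ p := by
      rw [← Real.mul_rpow hu.le]
      · congr 1; field_simp; ring
      · have : S / u ≤ 1 := (div_le_one hu).2 h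
        linarith
    have hle : (u - S) ^ p ≤ u ^ p := Real.rpow_le_rpow h0 (by linarith) (by linarith)
    have h3 : u ^ p * (1 + p * -(S / u)) ≤ (u - S) ^ p := by
      rw [e2]; gcongr
    have h4 : u ^ p * (1 + p * -(S / u)) = u ^ p - p * u ^ (p - 1) * S := by
      rw [hup]; field_simp; ring
    rw [e, abs_of_nonneg (by linarith)]
    linarith
  · have e1 : |u - S| = S - u := by rw [abs_of_neg (by linarith)]; ring
    have h1 : (S - u) ^ (p - 1) ≤ K ^ (p - 1) * u ^ (p - 1) := by
      rw [← Real.mul_rpow hK hu.le]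
      exact Real.rpow_le_rpow (by linarith) (by linarith) (by linarith)
    have h2 : (S - u) ^ (p - 1) * (S - u) ≤ K ^ (p - 1) * u ^ (p - 1) * S :=
      mul_le_mul h1 (by linarith) (by linarith) (by positivity)
    have h3 : 0 ≤ (S - u) ^ (p - 1) * (S - u) :=
      mul_nonneg (Real.rpow_nonneg (by linarith) _) (by linarith)
    have h4 : u ^ (p - 1) * u ≤ p * u ^ (p - 1) * S := by
      have : u ^ (p - 1) * u ≤ u ^ (p - 1) * S := by gcongr
      nlinarith [mul_nonneg hu1 hS]
    rw [e1, hup, abs_of_nonneg]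
    · nlinarith
    · nlinarith [mul_nonneg hu1 hu.le]

lemma bubble_pos (N : ℕ) (s : ℝ) {c : ℝ} (hc : 0 < c) (y : EuclideanSpace ℝ (Fin N)) :
    0 < bubble N s c y := by
  unfold bubble; positivity

lemma wBubble_nonneg (N : ℕ) (s : ℝ) {c μ : ℝ} (hc : 0 < c) (hμ : 0 < μ)
    (ξ y : EuclideanSpace ℝ (Fin N)) : 0 ≤ wBubble N s c μ ξ y :=
  mul_nonneg (by positivity) (bubble_pos N s hc _).le

/-- A rescaled bubble is dominated by its singular profile at the concentration point. -/
lemma wBubble_le (N : ℕ) (s : ℝ) {c μ : ℝ} (hc : 0 < c) (hμ : 0 < μ) (hm : 0 < (N : ℝ) - 2 * s)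
    (ξ y : EuclideanSpace ℝ (Fin N)) (h : 0 < ‖y - ξ‖) :
    wBubble N s c μ ξ y ≤
      c * μ ^ (((N : ℝ) - 2 * s) / 2) * ‖y - ξ‖ ^ (-((N : ℝ) - 2 * s)) := by
  unfold wBubble bubble
  set m := ((N : ℝ) - 2 * s) / 2 with hmdef
  have e : (N : ℝ) - 2 * s = 2 * m := by rw [hmdef]; ring
  rw [e] at hm ⊢
  set d := ‖y - ξ‖
  have h1 : 1 / (1 + ‖μ⁻¹ • (y - ξ)‖ ^ 2) ≤ μ ^ 2 * (d ^ 2)⁻¹ := by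
    have : ‖μ⁻¹ • (y - ξ)‖ = μ⁻¹ * d := by
      rw [norm_smul, Real.norm_of_nonneg (by positivity)]
    rw [this]
    have e3 : μ ^ 2 * (d ^ 2)⁻¹ = 1 / (μ⁻¹ * d) ^ 2 := by field_simp
    rw [e3]
    exact one_div_le_one_div_of_le (by positivity) (by linarith)
  have h2 : (1 / (1 + ‖μ⁻¹ • (y - ξ)‖ ^ 2)) ^ m ≤ (μ ^ 2 * (d ^ 2)⁻¹) ^ m :=
    Real.rpow_le_rpow (by positivity) h1 (by linarith)
  have h3 : μ ^ (-m) * (c * (μ ^ 2 * (d ^ 2)⁻¹) ^ m) = c * μ ^ m * d ^ (-(2 * m)) := by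
    rw [Real.mul_rpow (by positivity) (by positivity), Real.inv_rpow (by positivity),
      ← Real.rpow_natCast, ← Real.rpow_natCast, ← Real.rpow_mul hμ.le, ← Real.rpow_mul h.le,
      ← Real.rpow_neg h.le]
    have : μ ^ m = μ ^ (-m) * μ ^ (((2 : ℕ) : ℝ) * m) := by
      rw [← Real.rpow_add hμ]; congr 1; push_cast; ring
    rw [this]; push_cast; ring
  rw [← h3]
  gcongr

lemma norm_circPt_le (N : ℕ) (hN : 3 ≤ N) {r θ : ℝ} (hr0 : 0 ≤ r) :
    ‖circPt N r θ‖ ≤ r := by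
  obtain ⟨M, rfl⟩ : ∃ M, N = M + 2 := ⟨N - 2, by omega⟩
  rw [EuclideanSpace.norm_eq]
  apply Real.sqrt_le_iff.2 ⟨hr0, ?_⟩
  simp [circPt, Fin.sum_univ_succ]
  nlinarith [Real.sin_sq_add_cos_sq θ, sq_nonneg r]

/-- The chord between two points of a circle. -/
lemma abs_sin_le_norm_circPt_sub (N : ℕ) (hN : 3 ≤ N) (r θ φ : ℝ) :
    2 * r * |Real.sin ((θ - φ) / 2)| ≤ ‖circPt N r θ - circPt N r φ‖ := by
  obtain ⟨M, rfl⟩ : ∃ M, N = M + 2 := ⟨N - 2, by omega⟩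
  rw [EuclideanSpace.norm_eq]
  apply Real.le_sqrt_of_sq_le
  rw [mul_pow, sq_abs, Real.sin_sq_eq_half_sub]
  have : 2 * ((θ - φ) / 2) = θ - φ := by ring
  rw [this, Real.cos_sub]
  simp [circPt, Fin.sum_univ_succ]
  nlinarith [Real.sin_sq_add_cos_sq θ, Real.sin_sq_add_cos_sq φ]

/-- Jordan's inequality for `sin (π i / k)`, with the distance of `i` to the multiples of `k`. -/
lemma exists_le_abs_sin_pi_mul_div {k : ℕ} {i : ℤ} (hi0 : i ≠ 0) (hik : |i| < k) :
    ∃ b : ℤ, (b = i ∨ b = i - k ∨ b = i + k) ∧ b ≠ 0 ∧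
      2 * |(b : ℝ)| / k ≤ |Real.sin (Real.pi * i / k)| := by
  have hk : (0 : ℝ) < k := by
    have : (0 : ℤ) < k := lt_of_le_of_lt (abs_nonneg i) hik
    exact_mod_cast this
  have key : ∀ x : ℝ, |x| ≤ k / 2 → 2 * |x| / k ≤ |Real.sin (Real.pi * x / k)| := by
    intro x hx
    have h := Real.mul_abs_le_abs_sin (x := Real.pi * x / k) (by
      rw [abs_div, abs_mul, abs_of_pos Real.pi_pos, abs_of_pos hk, div_le_iff₀ hk]
      nlinarith [Real.pi_pos])
    refine le_trans (le_of_eq ?_) h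
    rw [abs_div, abs_mul, abs_of_pos Real.pi_pos, abs_of_pos hk]
    field_simp
  rw [abs_lt] at hik
  have h1 : (-(k : ℝ)) < i := by exact_mod_cast hik.1
  have h2 : (i : ℝ) < k := by exact_mod_cast hik.2
  by_cases ha : |(i : ℝ)| ≤ k / 2
  · exact ⟨i, Or.inl rfl, hi0, key _ ha⟩
  rcases le_or_gt (0 : ℝ) i with hpos | hneg
  · rw [abs_of_nonneg hpos] at ha
    refine ⟨i - k, Or.inr (Or.inl rfl), by omega, ?_⟩
    have h := key ((i : ℝ) - k) (by rw [abs_le]; constructor <;> linarith)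
    have e : Real.pi * ((i : ℝ) - k) / k = Real.pi * i / k - Real.pi := by field_simp
    rw [e, Real.sin_sub_pi, abs_neg] at h
    exact_mod_cast h
  · rw [abs_of_neg hneg] at ha
    refine ⟨i + k, Or.inr (Or.inr rfl), by omega, ?_⟩
    have h := key ((i : ℝ) + k) (by rw [abs_le]; constructor <;> linarith)
    have e : Real.pi * ((i : ℝ) + k) / k = Real.pi * i / k + Real.pi := by field_simp
    rw [e, Real.sin_add_pi, abs_neg] at h
    exact_mod_cast h

lemma rpow_neg_le_of_div_le {k n a d : ℝ} (hk : 0 < k) (hn : 0 < n) (ha : 0 < a)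
    (h : a / k ≤ d) : d ^ (-n) ≤ k ^ n * a ^ (-n) := by
  have h1 := Real.rpow_le_rpow_of_nonpos (div_pos ha hk) h (by linarith : -n ≤ 0)
  rwa [Real.div_rpow ha.le hk.le, Real.rpow_neg hk.le, div_inv_eq_mul, mul_comm] at h1

lemma sum_abs_shift_rpow_le {n : ℝ} (hn : 1 < n) (I : Finset ℕ) (t : ℤ) :
    ∑ j ∈ I, |(((j : ℤ) + t : ℤ) : ℝ)| ^ (-n) ≤ ∑' i : ℤ, |(i : ℝ)| ^ (-n) := by
  have hinj : Set.InjOn (fun j : ℕ => (j : ℤ) + t) I := by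
    intro a _ b _ h
    simpa using h
  rw [← Finset.sum_image (f := fun i : ℤ => |(i : ℝ)| ^ (-n)) hinj]
  exact (Real.summable_abs_int_rpow hn).sum_le_tsum _ (fun i _ => by positivity)

/-- Since the concentration points are `1/k`-separated, the sum of their singular profiles is of
order `k^n` away from them. -/
lemma sum_norm_sub_xiPt_rpow_le (N : ℕ) (hN : 3 ≤ N) {μ η n : ℝ} (hμ0 : 0 ≤ μ) (hμ : μ ≤ 1 / 2)
    (hη : 0 < η) (hn : 1 < n) {k : ℕ} (hk : 1 ≤ k) (y : EuclideanSpace ℝ (Fin N))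
    (hy : ∀ j ∈ Finset.Icc 1 k, η / k < ‖y - xiPt N μ k j‖) :
    ∑ j ∈ Finset.Icc 1 k, ‖y - xiPt N μ k j‖ ^ (-n) ≤
      (k : ℝ) ^ n * (η ^ (-n) + 3 * ∑' i : ℤ, |(i : ℝ)| ^ (-n)) := by
  have hk0 : (0 : ℝ) < k := by exact_mod_cast hk
  have hr : 1 / 2 ≤ Real.sqrt (1 - μ ^ 2) := by
    apply Real.le_sqrt_of_sq_le; nlinarith
  obtain ⟨j₀, hj₀, hmin⟩ := Finset.exists_min_image (Finset.Icc 1 k)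
    (fun j => ‖y - xiPt N μ k j‖) ⟨1, by simpa using hk⟩
  set f : ℤ → ℝ := fun i => |(i : ℝ)| ^ (-n) with hf
  have hf0 : ∀ i, 0 ≤ f i := fun i => by simp only [hf]; positivity
  have hterm : ∀ j ∈ Finset.Icc 1 k, ‖y - xiPt N μ k j‖ ^ (-n) ≤
      (k : ℝ) ^ n * ((if j = j₀ then η ^ (-n) else 0) +
        (f (j + (-j₀)) + f (j + (-j₀ - k)) + f (j + (-j₀ + k)))) := by
    intro j hj
    have p1 := hf0 (j + (-j₀))
    have p2 := hf0 (j + (-j₀ - k))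
    have p3 := hf0 (j + (-j₀ + k))
    by_cases hjj : j = j₀
    · refine (rpow_neg_le_of_div_le hk0 (by linarith) hη (hy j hj).le).trans ?_
      rw [if_pos hjj]
      gcongr
      linarith
    · rw [if_neg hjj, zero_add]
      rw [Finset.mem_Icc] at hj hj₀
      obtain ⟨b, hb, hb0, hbs⟩ := exists_le_abs_sin_pi_mul_div (k := k) (i := (j : ℤ) - j₀)
        (by omega) (by rw [abs_lt]; omega)
      have hch := abs_sin_le_norm_circPt_sub N hN (Real.sqrt (1 - μ ^ 2))
        (2 * Real.pi * ((j : ℝ) - 1) / k) (2 * Real.pi * ((j₀ : ℝ) - 1) / k)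
      have e : (2 * Real.pi * ((j : ℝ) - 1) / k - 2 * Real.pi * ((j₀ : ℝ) - 1) / k) / 2 =
          Real.pi * (((j : ℤ) - j₀ : ℤ) : ℝ) / k := by push_cast; ring
      rw [e] at hch
      have htri : ‖xiPt N μ k j - xiPt N μ k j₀‖ ≤ 2 * ‖y - xiPt N μ k j‖ := by
        have h1 := norm_sub_le (y - xiPt N μ k j₀) (y - xiPt N μ k j)
        have h2 := hmin j (Finset.mem_Icc.2 hj)
        rw [show y - xiPt N μ k j₀ - (y - xiPt N μ k j) =
          xiPt N μ k j - xiPt N μ k j₀ by abel] at h1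
        linarith
      have hd : |(b : ℝ)| / k ≤ ‖y - xiPt N μ k j‖ := by
        unfold xiPt at htri ⊢
        have h0 := abs_nonneg (Real.sin (Real.pi * (((j : ℤ) - j₀ : ℤ) : ℝ) / k))
        have h1 : 2 * |(b : ℝ)| / k = 2 * (|(b : ℝ)| / k) := by ring
        nlinarith
      refine (rpow_neg_le_of_div_le hk0 (by linarith)
        (abs_pos.2 (by exact_mod_cast hb0)) hd).trans ?_
      have hfb : f b ≤ f (j + (-j₀)) + f (j + (-j₀ - k)) + f (j + (-j₀ + k)) := by
        rcases hb with hb | hb | hb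
        · rw [show b = j + (-j₀) by omega]; linarith
        · rw [show b = j + (-j₀ - k) by omega]; linarith
        · rw [show b = j + (-j₀ + k) by omega]; linarith
      exact mul_le_mul_of_nonneg_left hfb (by positivity)
  refine (Finset.sum_le_sum hterm).trans ?_
  rw [← Finset.mul_sum]
  gcongr
  rw [Finset.sum_add_distrib, Finset.sum_add_distrib, Finset.sum_add_distrib,
    Finset.sum_ite_eq' _ _ (fun _ => η ^ (-n)), if_pos hj₀]
  have s1 := sum_abs_shift_rpow_le hn (Finset.Icc 1 k) (-j₀)
  have s2 := sum_abs_shift_rpow_le hn (Finset.Icc 1 k) (-j₀ - k)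
  have s3 := sum_abs_shift_rpow_le hn (Finset.Icc 1 k) (-j₀ + k)
  simp only [hf]
  linarith

/-- The sum of the singular profiles, with its decay at infinity. -/
lemma sum_norm_sub_xiPt_rpow_le_decay (N : ℕ) (hN : 3 ≤ N) {μ η m : ℝ} (hμ0 : 0 ≤ μ)
    (hμ : μ ≤ 1 / 2) (hη : 0 < η) (hm : 1 < 2 * m) {k : ℕ} (hk : 1 ≤ k)
    (y : EuclideanSpace ℝ (Fin N)) (hy : ∀ j ∈ Finset.Icc 1 k, η / k < ‖y - xiPt N μ k j‖) :
    ∑ j ∈ Finset.Icc 1 k, ‖y - xiPt N μ k j‖ ^ (-(2 * m)) ≤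
      (5 ^ m * (1 + η ^ (-(2 * m)) + 3 * ∑' i : ℤ, |(i : ℝ)| ^ (-(2 * m)))) *
        (k : ℝ) ^ (2 * m) * (1 / (1 + ‖y‖ ^ 2)) ^ m := by
  have hT : 0 ≤ ∑' i : ℤ, |(i : ℝ)| ^ (-(2 * m)) := tsum_nonneg fun i => by positivity
  set T := ∑' i : ℤ, |(i : ℝ)| ^ (-(2 * m))
  have hk1 : (1 : ℝ) ≤ k := by exact_mod_cast hk
  have hηp : 0 ≤ η ^ (-(2 * m)) := by positivity
  have hfive : (5 : ℝ) ^ m * (1 / (1 + ‖y‖ ^ 2)) ^ m = (5 / (1 + ‖y‖ ^ 2)) ^ m := by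
    rw [← Real.mul_rpow (by norm_num) (by positivity), mul_one_div]
  have e : ∀ B : ℝ, 5 ^ m * B * (k : ℝ) ^ (2 * m) * (1 / (1 + ‖y‖ ^ 2)) ^ m =
      (k : ℝ) ^ (2 * m) * B * (5 / (1 + ‖y‖ ^ 2)) ^ m := fun B => by rw [← hfive]; ring
  rw [e]
  rcases le_or_gt ‖y‖ 2 with h | h
  · have h1 : 1 ≤ (5 / (1 + ‖y‖ ^ 2)) ^ m := by
      apply Real.one_le_rpow _ (by linarith)
      rw [le_div_iff₀ (by positivity)]
      nlinarith [norm_nonneg y]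
    refine (sum_norm_sub_xiPt_rpow_le N hN hμ0 hμ hη hm hk y hy).trans ?_
    refine le_trans ?_ (le_mul_of_one_le_right (by positivity) h1)
    gcongr
    linarith
  · have hterm : ∀ j ∈ Finset.Icc 1 k, ‖y - xiPt N μ k j‖ ^ (-(2 * m)) ≤
        (5 / (1 + ‖y‖ ^ 2)) ^ m := by
      intro j _
      have hxi : ‖xiPt N μ k j‖ ≤ 1 := (norm_circPt_le N hN (Real.sqrt_nonneg _)).trans
        (Real.sqrt_le_one.2 (by nlinarith [sq_nonneg μ]))
      have h1 := norm_sub_norm_le y (xiPt N μ k j)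
      set d := ‖y - xiPt N μ k j‖
      have hd : ‖y‖ / 2 ≤ d := by linarith
      have hd0 : 0 < d := by linarith
      rw [Real.rpow_neg hd0.le, ← Real.inv_rpow hd0.le, Real.rpow_mul (by positivity)]
      apply Real.rpow_le_rpow (by positivity) _ (by linarith)
      rw [Real.rpow_two, inv_pow, inv_eq_one_div, div_le_div_iff₀ (by positivity) (by positivity)]
      nlinarith
    refine (Finset.sum_le_card_nsmul _ _ _ hterm).trans ?_
    rw [Nat.card_Icc, nsmul_eq_mul, Nat.add_sub_cancel]
    gcongr
    have h2 : (k : ℝ) ≤ (k : ℝ) ^ (2 * m) := Real.self_le_rpow_of_one_le hk1 hm.le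
    refine h2.trans (le_mul_of_one_le_right (by positivity) (by linarith))

/-- Pointwise estimate for the error in the exterior region
`EX = {y : |y - ξ_j| > η/k for all j}`. -/
theorem error_pointwise_exterior_estimate
    (N : ℕ) (hN : 3 ≤ N) (s : ℝ) (hs : s ∈ Set.Ioo (0 : ℝ) 1) (c : ℝ) (hc : 0 < c)
    (δ : ℝ) (hδ : 0 < δ) (η : ℝ) (hη : η ∈ Set.Ioo (0 : ℝ) 1) :
    ∃ k₀ : ℕ, 2 ≤ k₀ ∧ ∃ C : ℝ, 0 < C ∧ ∀ k : ℕ, k₀ ≤ k →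
      ∀ y : EuclideanSpace ℝ (Fin N),
        (∀ j ∈ Finset.Icc 1 k, η / k < ‖y - xiPt N (muK N s δ k) k j‖) →
        |errFun N s c δ k y| ≤
          C * muK N s δ k ^ (((N : ℝ) - 2 * s) / 2) * (1 + ‖y‖ ^ 2) ^ (-(2 * s)) *
            ∑ j ∈ Finset.Icc 1 k, ‖y - xiPt N (muK N s δ k) k j‖ ^ (-((N : ℝ) - 2 * s)) := by
  obtain ⟨hs0, hs1⟩ := hs
  obtain ⟨hη0, hη1⟩ := hη
  have hN3 : (3 : ℝ) ≤ N := by exact_mod_cast hN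
  set m : ℝ := ((N : ℝ) - 2 * s) / 2 with hmdef
  have e : (N : ℝ) - 2 * s = 2 * m := by rw [hmdef]; ring
  have hm : 1 < 2 * m := by linarith
  have hm0 : 0 < m := by linarith
  set p := pExp N s with hpdef
  have hp1 : m * (p - 1) = 2 * s := by
    have : (N : ℝ) - 2 * s ≠ 0 := by linarith
    rw [hpdef, hmdef]; unfold pExp; field_simp; ring
  have hp : 1 < p := by nlinarith
  set A : ℝ := 5 ^ m * (1 + η ^ (-(2 * m)) + 3 * ∑' i : ℤ, |(i : ℝ)| ^ (-(2 * m))) with hA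
  have hA0 : 0 ≤ A := by
    have hT : 0 ≤ ∑' i : ℤ, |(i : ℝ)| ^ (-(2 * m)) := tsum_nonneg fun i => by positivity
    positivity
  set D : ℝ := δ ^ (2 / ((N : ℝ) - 2 * s)) with hD
  have hD0 : 0 < D := by positivity
  have hDm : D ^ m = δ := by
    rw [hD, ← Real.rpow_mul hδ.le, e, show 2 / (2 * m) * m = 1 by field_simp, Real.rpow_one]
  set K : ℝ := A * δ with hK
  have hK0 : 0 ≤ K := by positivity
  refine ⟨⌈2 * D⌉₊ + 2, by omega, (p + 2 * K ^ (p - 1)) * c ^ (p - 1) * c, by positivity, ?_⟩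
  intro k hk y hy
  have hk1 : (1 : ℝ) ≤ k := by exact_mod_cast (by omega : 1 ≤ k)
  have hkD : 2 * D ≤ k := (Nat.le_ceil _).trans (by exact_mod_cast (by omega : ⌈2 * D⌉₊ ≤ k))
  set μ := muK N s δ k with hμdef
  have hμD : μ = D * (k : ℝ) ^ (-3 : ℝ) := rfl
  have hμ0 : 0 < μ := by rw [hμD]; positivity
  have hμ : μ ≤ 1 / 2 := by
    have h1 : (k : ℝ) ^ (-3 : ℝ) ≤ (k : ℝ) ^ (-1 : ℝ) :=
      Real.rpow_le_rpow_of_exponent_le hk1 (by norm_num)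
    rw [Real.rpow_neg_one] at h1
    calc μ ≤ D * (k : ℝ)⁻¹ := by rw [hμD]; gcongr
      _ ≤ 1 / 2 := by
        rw [← div_eq_mul_inv, div_le_div_iff₀ (by linarith) (by norm_num)]; linarith
  have hμm : μ ^ m * (k : ℝ) ^ (2 * m) ≤ δ := by
    rw [hμD, Real.mul_rpow hD0.le (by positivity), hDm, ← Real.rpow_mul (by linarith), mul_assoc,
      ← Real.rpow_add (by linarith)]
    exact mul_le_of_le_one_right hδ.le (Real.rpow_le_one_of_one_le_of_nonpos hk1 (by linarith))
  set W : ℕ → ℝ := fun j => wBubble N s c μ (xiPt N μ k j) y with hW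
  set u := bubble N s c y with hu
  have hu0 : 0 < u := bubble_pos N s hc y
  have hW0 : ∀ j, 0 ≤ W j := fun j => wBubble_nonneg N s hc hμ0 _ y
  set S := ∑ j ∈ Finset.Icc 1 k, W j with hS
  set R := ∑ j ∈ Finset.Icc 1 k, ‖y - xiPt N μ k j‖ ^ (-((N : ℝ) - 2 * s)) with hR
  have hS0 : 0 ≤ S := Finset.sum_nonneg fun j _ => hW0 j
  have hSR : S ≤ c * μ ^ m * R := by
    rw [hR, Finset.mul_sum]
    refine Finset.sum_le_sum fun j hj => wBubble_le N s hc hμ0 (by linarith) _ y ?_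
    exact lt_trans (by positivity) (hy j hj)
  have hRA : R ≤ A * (k : ℝ) ^ (2 * m) * (1 / (1 + ‖y‖ ^ 2)) ^ m := by
    rw [hR, e]
    exact sum_norm_sub_xiPt_rpow_le_decay N hN hμ0.le hμ hη0 hm (by omega) y hy
  have hue : u = c * (1 / (1 + ‖y‖ ^ 2)) ^ m := rfl
  have hSK : S ≤ K * u := by
    calc S ≤ c * μ ^ m * (A * (k : ℝ) ^ (2 * m) * (1 / (1 + ‖y‖ ^ 2)) ^ m) := by
          refine hSR.trans ?_; gcongr
      _ = (μ ^ m * (k : ℝ) ^ (2 * m)) * (A * u) := by rw [hue]; ring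
      _ ≤ δ * (A * u) := by gcongr
      _ = K * u := by rw [hK]; ring
  have hup : u ^ (p - 1) = c ^ (p - 1) * (1 + ‖y‖ ^ 2) ^ (-(2 * s)) := by
    rw [hue, Real.mul_rpow hc.le (by positivity), ← Real.rpow_mul (by positivity), hp1,
      one_div, Real.inv_rpow (by positivity), ← Real.rpow_neg (by positivity)]
  have hsum0 : 0 ≤ ∑ j ∈ Finset.Icc 1 k, W j ^ p :=
    Finset.sum_nonneg fun j _ => Real.rpow_nonneg (hW0 j) _
  have hsum : ∑ j ∈ Finset.Icc 1 k, W j ^ p ≤ K ^ (p - 1) * u ^ (p - 1) * S := by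
    rw [hS, Finset.mul_sum]
    refine Finset.sum_le_sum fun j hj => ?_
    have hWS : W j ≤ K * u :=
      (Finset.single_le_sum (fun i _ => hW0 i) hj).trans hSK
    have h1 : W j ^ p = W j ^ (p - 1) * W j := by
      rw [← Real.rpow_add_one' (hW0 j) (by linarith)]; ring_nf
    rw [h1, ← Real.mul_rpow hK0 hu0.le]
    exact mul_le_mul_of_nonneg_right
      (Real.rpow_le_rpow (hW0 j) hWS (by linarith)) (hW0 j)
  have hmain := abs_rpow_sub_signed_rpow_le hu0 hS0 hSK hK0 hp
  have hE : errFun N s c δ k y =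
      (u ^ p - |u - S| ^ (p - 1) * (u - S)) - ∑ j ∈ Finset.Icc 1 k, W j ^ p := by
    change u ^ p - ∑ j ∈ Finset.Icc 1 k, W j ^ p - |u - S| ^ (p - 1) * (u - S) = _
    ring
  calc |errFun N s c δ k y|
      ≤ |u ^ p - |u - S| ^ (p - 1) * (u - S)| + |∑ j ∈ Finset.Icc 1 k, W j ^ p| := by
        rw [hE]; exact abs_sub _ _
    _ ≤ (p + K ^ (p - 1)) * u ^ (p - 1) * S + K ^ (p - 1) * u ^ (p - 1) * S := by
        rw [abs_of_nonneg hsum0]; gcongr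
    _ = (p + 2 * K ^ (p - 1)) * u ^ (p - 1) * S := by ring
    _ ≤ (p + 2 * K ^ (p - 1)) * u ^ (p - 1) * (c * μ ^ m * R) := by gcongr
    _ = (p + 2 * K ^ (p - 1)) * c ^ (p - 1) * c * μ ^ m * (1 + ‖y‖ ^ 2) ^ (-(2 * s)) * R := by
        rw [hup]; ring

end
end

section
/- Let q satisfy N/(2s) < q < N/s and let r = 2N/(N+2s). There exists a constant C > 0, depending only on N, s and q, such that every measurable function h : ℝ^N → ℝ satisfies ‖h‖_{L^r(ℝ^N)} ≤ C ‖h‖_**. -/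
open MeasureTheory Real ENNReal

noncomputable section

/-- Hölder's inequality against the weight `(1 + ‖y‖) ^ (a / q)`, where `1 / r = 1 / q + 1 / t`. -/
theorem eLpNorm_le_lintegral_weight_mul {E : Type*} [NormedAddCommGroup E] [MeasurableSpace E]
    [OpensMeasurableSpace E] (μ : Measure E) {r q t : ℝ} (a : ℝ) (hr : 0 < r) (hrq : r < q)
    (ht : 0 < t) (hrqt : 1 / r = 1 / q + 1 / t) {h : E → ℝ} (hh : Measurable h) :
    eLpNorm h (ENNReal.ofReal r) μ ≤
      (∫⁻ y, ENNReal.ofReal ((1 + ‖y‖) ^ (-(a * t / q))) ∂μ) ^ (1 / t) *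
        (∫⁻ y, ENNReal.ofReal ((1 + ‖y‖) ^ a * |h y| ^ q) ∂μ) ^ (1 / q) := by
  have hq : 0 < q := hr.trans hrq
  have hpos (y : E) : 0 < 1 + ‖y‖ := by positivity
  let f : E → ℝ≥0∞ := fun y ↦ ENNReal.ofReal ((1 + ‖y‖) ^ (a / q) * |h y|)
  let g : E → ℝ≥0∞ := fun y ↦ ENNReal.ofReal ((1 + ‖y‖) ^ (-(a / q)))
  have hf : Measurable f := by fun_prop
  have hg : Measurable g := by fun_prop
  have hfg (y : E) : ‖h y‖ₑ = (f * g) y := by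
    have : (1 + ‖y‖) ^ (a / q) ≠ 0 := (Real.rpow_pos_of_pos (hpos y) _).ne'
    simp only [f, g, Pi.mul_apply]
    rw [← ENNReal.ofReal_mul (by positivity), Real.rpow_neg (hpos y).le, Real.enorm_eq_ofReal_abs]
    congr 1
    field_simp
  have hfq (y : E) : f y ^ q = ENNReal.ofReal ((1 + ‖y‖) ^ a * |h y| ^ q) := by
    simp only [f]
    rw [ENNReal.ofReal_rpow_of_nonneg (by positivity) hq.le,
      Real.mul_rpow (by positivity) (abs_nonneg _), ← Real.rpow_mul (hpos y).le,
      div_mul_cancel₀ _ hq.ne']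
  have hgt (y : E) : g y ^ t = ENNReal.ofReal ((1 + ‖y‖) ^ (-(a * t / q))) := by
    simp only [g]
    rw [ENNReal.ofReal_rpow_of_nonneg (by positivity) ht.le, ← Real.rpow_mul (hpos y).le]
    congr 2
    ring
  rw [eLpNorm_eq_lintegral_rpow_enorm_toReal (by simpa using hr) ENNReal.ofReal_ne_top,
    ENNReal.toReal_ofReal hr.le]
  simp_rw [hfg, ← hfq, ← hgt]
  rw [mul_comm (_ ^ (1 / t))]
  exact ENNReal.lintegral_Lp_mul_le_Lq_mul_Lr hr hrq hrqt μ hf.aemeasurable hg.aemeasurable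

/-- The `‖·‖_**` norm controls the `L^r` norm, `r = 2N/(N+2s)`. -/
theorem Lr_le_starstar
    (N : ℕ) (hN : 3 ≤ N) (s : ℝ) (hs : s ∈ Set.Ioo (0 : ℝ) 1)
    (q : ℝ) (hq1 : (N : ℝ) / (2 * s) < q) (hq2 : q < (N : ℝ) / s) :
    ∃ C : ℝ, 0 < C ∧ ∀ h : EuclideanSpace ℝ (Fin N) → ℝ, Measurable h →
      eLpNorm h (ENNReal.ofReal (2 * N / ((N : ℝ) + 2 * s))) volume ≤
        ENNReal.ofReal C * starstarNorm N s q h := by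
  obtain ⟨hs0, hs1⟩ := hs
  have hN3 : (3 : ℝ) ≤ N := by exact_mod_cast hN
  have hN0 : (0 : ℝ) < N := by linarith
  have hq0 : 0 < q := lt_trans (by positivity) hq1
  have hrq : 2 * N / ((N : ℝ) + 2 * s) < q := by
    refine lt_trans ?_ hq1
    rw [div_lt_div_iff₀ (by positivity) (by positivity)]
    nlinarith
  set a : ℝ := ((N : ℝ) + 2 * s) * q - 2 * N with ha_def
  have ha : 0 < a := by
    rw [div_lt_iff₀ (by positivity)] at hrq
    linarith
  have ht : 0 < 2 * N * q / a := by positivity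
  have hexp : a * (2 * N * q / a) / q = 2 * N := by field_simp
  have hrqt : 1 / (2 * N / ((N : ℝ) + 2 * s)) = 1 / q + 1 / (2 * N * q / a) := by
    field_simp
    rw [ha_def]
    ring
  set K : ℝ≥0∞ := (∫⁻ y : EuclideanSpace ℝ (Fin N),
    ENNReal.ofReal ((1 + ‖y‖) ^ (-(2 * N : ℝ)))) ^ (1 / (2 * N * q / a))
  have hK : K ≠ ∞ := by
    refine ENNReal.rpow_ne_top_of_nonneg (by positivity) (ne_of_lt ?_)
    refine finite_integral_one_add_norm ?_
    rw [finrank_euclideanSpace_fin]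
    linarith
  refine ⟨K.toReal + 1, by positivity, fun h hh ↦ ?_⟩
  have key := eLpNorm_le_lintegral_weight_mul volume a (by positivity) hrq ht hrqt hh
  rw [hexp] at key
  refine key.trans (mul_le_mul_left ?_ _)
  exact ENNReal.le_ofReal_iff_toReal_le hK (by positivity) |>.2 (by linarith)

end
end

section
/- Let k ≥ 2 be an integer and let R : ℝ^N → ℝ^N be the rotation by angle 2π/k in the first two coordinates (acting as the identity on the remaining N−2 coordinates). Suppose h : ℝ^N → ℝ is measurable, satisfies h(Ry) = h(y) for almost every y, and ∫_{ℝ^N} (1+|y|)^{−(N−2s+1)} |h(y)| dy < ∞. Then ∫_{ℝ^N} h(y) ∂U/∂y₁(y) dy = 0 and ∫_{ℝ^N} h(y) ∂U/∂y₂(y) dy = 0. -/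
open MeasureTheory Real ENNReal

noncomputable section

/-- Rotation by angle `θ` in the first two coordinates of `ℝ^N`, the identity on the rest. -/
def rot2 (N : ℕ) (hN : 2 ≤ N) (θ : ℝ) (y : EuclideanSpace ℝ (Fin N)) :
    EuclideanSpace ℝ (Fin N) :=
  (EuclideanSpace.equiv (Fin N) ℝ).symm (fun i =>
    if (i : ℕ) = 0 then
      Real.cos θ * EuclideanSpace.equiv (Fin N) ℝ y ⟨0, by omega⟩ -
        Real.sin θ * EuclideanSpace.equiv (Fin N) ℝ y ⟨1, by omega⟩
    else if (i : ℕ) = 1 then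
      Real.sin θ * EuclideanSpace.equiv (Fin N) ℝ y ⟨0, by omega⟩ +
        Real.cos θ * EuclideanSpace.equiv (Fin N) ℝ y ⟨1, by omega⟩
    else EuclideanSpace.equiv (Fin N) ℝ y i)
lemma rot2_apply {N : ℕ} (hN : 2 ≤ N) (θ : ℝ) (y : EuclideanSpace ℝ (Fin N)) (i : Fin N) :
    rot2 N hN θ y i =
      if (i : ℕ) = 0 then Real.cos θ * y ⟨0, by omega⟩ - Real.sin θ * y ⟨1, by omega⟩
      else if (i : ℕ) = 1 then Real.sin θ * y ⟨0, by omega⟩ + Real.cos θ * y ⟨1, by omega⟩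
      else y i :=
  rfl

lemma norm_rot2 {N : ℕ} (hN : 2 ≤ N) (θ : ℝ) (y : EuclideanSpace ℝ (Fin N)) :
    ‖rot2 N hN θ y‖ = ‖y‖ := by
  obtain ⟨m, rfl⟩ := Nat.exists_eq_add_of_le' hN
  rw [← sq_eq_sq₀ (norm_nonneg _) (norm_nonneg _), EuclideanSpace.real_norm_sq_eq,
    EuclideanSpace.real_norm_sq_eq]
  simp only [Fin.sum_univ_succ, rot2_apply]
  have h0 : (⟨0, by omega⟩ : Fin (m + 2)) = 0 := rfl
  have h1 : (⟨1, by omega⟩ : Fin (m + 2)) = (0 : Fin (m + 1)).succ := rfl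
  simp only [h0, h1, Fin.val_zero, Fin.val_succ, if_true, zero_add, one_ne_zero, if_false,
    Nat.add_eq_zero_iff, and_false, Nat.add_eq_right]
  linear_combination
    (y 0 ^ 2 + y (0 : Fin (m + 1)).succ ^ 2) * Real.sin_sq_add_cos_sq θ

/-- The rotation `rot2` as a linear isometric automorphism of `ℝ^N`. -/
def rot2Isometry (N : ℕ) (hN : 2 ≤ N) (θ : ℝ) :
    EuclideanSpace ℝ (Fin N) ≃ₗᵢ[ℝ] EuclideanSpace ℝ (Fin N) :=
  LinearIsometry.toLinearIsometryEquiv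
    { toFun := rot2 N hN θ
      map_add' := fun x y => by
        ext i
        simp only [rot2_apply, PiLp.add_apply]
        split_ifs <;> ring
      map_smul' := fun a y => by
        ext i
        simp only [rot2_apply, PiLp.smul_apply, smul_eq_mul, RingHom.id_apply]
        split_ifs <;> ring
      norm_map' := norm_rot2 hN θ } rfl

@[simp]
lemma rot2Isometry_apply {N : ℕ} (hN : 2 ≤ N) (θ : ℝ) (y : EuclideanSpace ℝ (Fin N)) :
    rot2Isometry N hN θ y = rot2 N hN θ y :=
  rfl

lemma rot2_single_zero {N : ℕ} (hN : 2 ≤ N) (θ : ℝ) :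
    rot2 N hN θ (EuclideanSpace.single ⟨0, by omega⟩ 1) =
      Real.cos θ • EuclideanSpace.single ⟨0, by omega⟩ 1 +
        Real.sin θ • EuclideanSpace.single ⟨1, by omega⟩ 1 := by
  ext ⟨i, hi⟩
  simp only [rot2_apply, PiLp.add_apply, PiLp.smul_apply, smul_eq_mul,
    PiLp.single_apply, Fin.mk.injEq]
  split_ifs <;> first | contradiction | omega | simp

lemma rot2_single_one {N : ℕ} (hN : 2 ≤ N) (θ : ℝ) :
    rot2 N hN θ (EuclideanSpace.single ⟨1, by omega⟩ 1) =
      -Real.sin θ • EuclideanSpace.single ⟨0, by omega⟩ 1 +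
        Real.cos θ • EuclideanSpace.single ⟨1, by omega⟩ 1 := by
  ext ⟨i, hi⟩
  simp only [rot2_apply, PiLp.add_apply, PiLp.smul_apply, smul_eq_mul,
    PiLp.single_apply, Fin.mk.injEq]
  split_ifs <;> first | contradiction | omega | simp

lemma bubble_comp_isometry {N : ℕ} (s c : ℝ)
    (L : EuclideanSpace ℝ (Fin N) ≃ₗᵢ[ℝ] EuclideanSpace ℝ (Fin N)) :
    bubble N s c ∘ L = bubble N s c := by
  ext y
  simp [bubble]

lemma fderiv_bubble_isometry {N : ℕ} (s c : ℝ)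
    (L : EuclideanSpace ℝ (Fin N) ≃ₗᵢ[ℝ] EuclideanSpace ℝ (Fin N))
    (y v : EuclideanSpace ℝ (Fin N)) :
    fderiv ℝ (bubble N s c) (L y) (L v) = fderiv ℝ (bubble N s c) y v := by
  have h := L.toContinuousLinearEquiv.comp_right_fderiv (f := bubble N s c) (x := y)
  have hc : bubble N s c ∘ L.toContinuousLinearEquiv = bubble N s c := bubble_comp_isometry s c L
  rw [hc] at h
  rw [h]
  rfl

lemma hasFDerivAt_bubble {N : ℕ} (s c : ℝ) (y : EuclideanSpace ℝ (Fin N)) :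
    HasFDerivAt (bubble N s c)
      ((-c * ((N : ℝ) - 2 * s) * (1 + ‖y‖ ^ 2) ^ (-((N : ℝ) - 2 * s) / 2 - 1)) •
        innerSL ℝ y) y := by
  have hb : bubble N s c = fun y => c * (1 + ‖y‖ ^ 2) ^ (-((N : ℝ) - 2 * s) / 2) := by
    ext y
    rw [bubble, one_div, Real.inv_rpow (by positivity), ← Real.rpow_neg (by positivity), neg_div]
  rw [hb]
  have h := ((((hasStrictFDerivAt_norm_sq y).hasFDerivAt.const_add 1).rpow_const
    (p := -((N : ℝ) - 2 * s) / 2) (Or.inl (by positivity))).const_mul c)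
  refine h.congr_fderiv ?_
  ext v
  simp
  ring

lemma abs_fderiv_bubble_le {N : ℕ} {s c : ℝ} (hs : 2 * s ≤ N) (hc : 0 ≤ c)
    (y v : EuclideanSpace ℝ (Fin N)) :
    |fderiv ℝ (bubble N s c) y v| ≤
      c * ((N : ℝ) - 2 * s) * ‖v‖ * 2 ^ (((N : ℝ) - 2 * s + 1) / 2) *
        (1 + ‖y‖) ^ (-((N : ℝ) - 2 * s + 1)) := by
  rw [(hasFDerivAt_bubble s c y).fderiv]
  set b : ℝ := (N : ℝ) - 2 * s with hb
  have hb0 : 0 ≤ b := by linarith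
  have hpos : 0 < 1 + ‖y‖ ^ 2 := by positivity
  have hy : ‖y‖ ≤ (1 + ‖y‖ ^ 2) ^ (1 / 2 : ℝ) := by
    rw [← Real.sqrt_eq_rpow]
    exact Real.le_sqrt_of_sq_le (by linarith)
  have hdecay : (1 + ‖y‖ ^ 2) ^ (-(b + 1) / 2) ≤
      2 ^ ((b + 1) / 2) * (1 + ‖y‖) ^ (-(b + 1)) := by
    have h1 : (1 + ‖y‖) ^ 2 / 2 ≤ 1 + ‖y‖ ^ 2 := by nlinarith [sq_nonneg (1 - ‖y‖)]
    calc (1 + ‖y‖ ^ 2) ^ (-(b + 1) / 2) ≤ ((1 + ‖y‖) ^ 2 / 2) ^ (-(b + 1) / 2) :=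
          Real.rpow_le_rpow_of_nonpos (by positivity) h1 (by linarith)
      _ = 2 ^ ((b + 1) / 2) * (1 + ‖y‖) ^ (-(b + 1)) := by
          rw [Real.div_rpow (by positivity) (by norm_num), ← Real.rpow_natCast,
            ← Real.rpow_mul (by positivity), neg_div, Real.rpow_neg (by norm_num : (0 : ℝ) ≤ 2),
            div_inv_eq_mul, mul_comm]
          congr 2
          push_cast
          ring
  have hinner : |inner ℝ y v| ≤ (1 + ‖y‖ ^ 2) ^ (1 / 2 : ℝ) * ‖v‖ :=
    (abs_real_inner_le_norm y v).trans (by gcongr)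
  calc |((-c * b * (1 + ‖y‖ ^ 2) ^ (-b / 2 - 1)) • innerSL ℝ y) v|
      = c * b * (1 + ‖y‖ ^ 2) ^ (-b / 2 - 1) * |inner ℝ y v| := by
        simp [abs_mul, abs_of_nonneg hc, abs_of_nonneg hb0,
          abs_of_nonneg (Real.rpow_nonneg hpos.le _)]
    _ ≤ c * b * (1 + ‖y‖ ^ 2) ^ (-b / 2 - 1) * ((1 + ‖y‖ ^ 2) ^ (1 / 2 : ℝ) * ‖v‖) := by gcongr
    _ = c * b * ‖v‖ * (1 + ‖y‖ ^ 2) ^ (-(b + 1) / 2) := by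
        have : (1 + ‖y‖ ^ 2) ^ (-(b + 1) / 2) =
            (1 + ‖y‖ ^ 2) ^ (-b / 2 - 1) * (1 + ‖y‖ ^ 2) ^ (1 / 2 : ℝ) := by
          rw [← Real.rpow_add hpos]
          ring_nf
        rw [this]
        ring
    _ ≤ c * b * ‖v‖ * (2 ^ ((b + 1) / 2) * (1 + ‖y‖) ^ (-(b + 1))) := by gcongr
    _ = _ := by ring

lemma integrable_mul_fderiv_bubble {N : ℕ} {s c : ℝ} (hs : 2 * s ≤ N) (hc : 0 ≤ c)
    {h : EuclideanSpace ℝ (Fin N) → ℝ} (hmeas : Measurable h)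
    (hint : (∫⁻ y : EuclideanSpace ℝ (Fin N),
      ENNReal.ofReal ((1 + ‖y‖) ^ (-((N : ℝ) - 2 * s + 1)) * |h y|)) < ⊤)
    (v : EuclideanSpace ℝ (Fin N)) :
    Integrable (fun y => h y * fderiv ℝ (bubble N s c) y v) := by
  have hw : Integrable (fun y : EuclideanSpace ℝ (Fin N) =>
      (1 + ‖y‖) ^ (-((N : ℝ) - 2 * s + 1)) * |h y|) := by
    refine ⟨by fun_prop, ?_⟩
    rwa [hasFiniteIntegral_iff_ofReal (Filter.Eventually.of_forall fun y => by positivity)]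
  refine (hw.const_mul (c * ((N : ℝ) - 2 * s) * ‖v‖ * 2 ^ (((N : ℝ) - 2 * s + 1) / 2))).mono'
    (hmeas.mul (measurable_fderiv_apply_const ℝ _ v)).aestronglyMeasurable
    (Filter.Eventually.of_forall fun y => ?_)
  rw [Real.norm_eq_abs, abs_mul, mul_comm, ← mul_assoc]
  gcongr
  exact abs_fderiv_bubble_le hs hc y v

lemma integral_mul_fderiv_bubble_isometry {N : ℕ} (s c : ℝ)
    {h : EuclideanSpace ℝ (Fin N) → ℝ}
    (L : EuclideanSpace ℝ (Fin N) ≃ₗᵢ[ℝ] EuclideanSpace ℝ (Fin N))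
    (hL : ∀ᵐ y, h (L y) = h y) (v : EuclideanSpace ℝ (Fin N)) :
    ∫ y, h y * fderiv ℝ (bubble N s c) y (L v) = ∫ y, h y * fderiv ℝ (bubble N s c) y v := by
  rw [← L.measurePreserving.integral_comp L.toHomeomorph.measurableEmbedding]
  refine integral_congr_ae ?_
  filter_upwards [hL] with y hy
  rw [hy, fderiv_bubble_isometry]

lemma cos_two_pi_div_lt_one {k : ℕ} (hk : 2 ≤ k) : Real.cos (2 * Real.pi / k) < 1 := by
  have hk' : (2 : ℝ) ≤ k := by exact_mod_cast hk
  rw [← Real.cos_zero]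
  refine Real.cos_lt_cos_of_nonneg_of_le_pi le_rfl ?_ (by positivity)
  rw [div_le_iff₀ (by positivity)]
  nlinarith [Real.pi_pos]

/-- If `h` is invariant under the rotation by `2π/k` (`k ≥ 2`) in the first two coordinates
and suitably integrable, then `h` is orthogonal to `∂U/∂y₁` and `∂U/∂y₂`. -/
theorem rotation_invariant_orthogonal_to_translations
    (N : ℕ) (hN : 3 ≤ N) (s : ℝ) (hs : s ∈ Set.Ioo (0 : ℝ) 1) (c : ℝ) (hc : 0 < c)
    (k : ℕ) (hk : 2 ≤ k) (h : EuclideanSpace ℝ (Fin N) → ℝ) (hmeas : Measurable h)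
    (hrot : ∀ᵐ y : EuclideanSpace ℝ (Fin N),
      h (rot2 N (by omega) (2 * Real.pi / k) y) = h y)
    (hint : (∫⁻ y : EuclideanSpace ℝ (Fin N),
      ENNReal.ofReal ((1 + ‖y‖) ^ (-((N : ℝ) - 2 * s + 1)) * |h y|)) < ⊤) :
    (∫ y : EuclideanSpace ℝ (Fin N),
        h y * fderiv ℝ (bubble N s c) y (EuclideanSpace.single ⟨0, by omega⟩ 1)) = 0 ∧
    (∫ y : EuclideanSpace ℝ (Fin N),
        h y * fderiv ℝ (bubble N s c) y (EuclideanSpace.single ⟨1, by omega⟩ 1)) = 0 := by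
  set θ : ℝ := 2 * Real.pi / k
  have hsN : 2 * s ≤ N := by
    have : (3 : ℝ) ≤ N := by exact_mod_cast hN
    linarith [hs.2]
  have hI := integrable_mul_fderiv_bubble hsN hc.le hmeas hint
  have hlin : ∀ (a b : ℝ) (v w : EuclideanSpace ℝ (Fin N)),
      ∫ y, h y * fderiv ℝ (bubble N s c) y (a • v + b • w) =
        a * (∫ y, h y * fderiv ℝ (bubble N s c) y v) +
          b * ∫ y, h y * fderiv ℝ (bubble N s c) y w := by
    intro a b v w
    rw [← integral_const_mul, ← integral_const_mul,
      ← integral_add ((hI v).const_mul a) ((hI w).const_mul b)]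
    congr 1 with y
    simp only [map_add, map_smul, smul_eq_mul]
    ring
  have hinv := integral_mul_fderiv_bubble_isometry s c (rot2Isometry N (by omega) θ) hrot
  have h0 := hinv (EuclideanSpace.single ⟨0, by omega⟩ 1)
  have h1 := hinv (EuclideanSpace.single ⟨1, by omega⟩ 1)
  rw [rot2Isometry_apply, rot2_single_zero, hlin] at h0
  rw [rot2Isometry_apply, rot2_single_one, hlin] at h1
  have hdet : 2 - 2 * Real.cos θ ≠ 0 := by linarith [cos_two_pi_div_lt_one hk]
  have hsc := Real.sin_sq_add_cos_sq θ
  generalize (∫ y, h y * fderiv ℝ (bubble N s c) y (EuclideanSpace.single ⟨0, by omega⟩ 1)) = A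
    at h0 h1 ⊢
  generalize (∫ y, h y * fderiv ℝ (bubble N s c) y (EuclideanSpace.single ⟨1, by omega⟩ 1)) = B
    at h0 h1 ⊢
  constructor
  · refine (mul_eq_zero.mp ?_).resolve_left hdet
    linear_combination (Real.cos θ - 1) * h0 - Real.sin θ * h1 - A * hsc
  · refine (mul_eq_zero.mp ?_).resolve_left hdet
    linear_combination Real.sin θ * h0 + (Real.cos θ - 1) * h1 - B * hsc
end
end

section
/- Suppose h : ℝ^N → ℝ is measurable, satisfies the Kelvin relation h(y) = |y|^{−(N+2s)} h(y/|y|²) for almost every y ≠ 0, and ∫_{ℝ^N} (1+|y|)^{−(N−2s)} |h(y)| dy < ∞. Then for every λ > 0, λ^{(N−2s)/2} ∫_{ℝ^N} U(λ y) h(y) dy = λ^{−(N−2s)/2} ∫_{ℝ^N} U(y/λ) h(y) dy; that is, the function I(λ) = λ^{(N−2s)/2} ∫ U(λy) h(y) dy satisfies I(λ) = I(1/λ). -/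
open MeasureTheory Real ENNReal

noncomputable section

section Inversion

variable {E : Type*} [NormedAddCommGroup E] [InnerProductSpace ℝ E]

theorem inversion_zero_one_eq (x : E) :
    EuclideanGeometry.inversion (0 : E) 1 x = (‖x‖ ^ 2)⁻¹ • x := by
  simp [EuclideanGeometry.inversion]

theorem norm_inv_norm_sq_smul (x : E) : ‖(‖x‖ ^ 2)⁻¹ • x‖ = ‖x‖⁻¹ := by
  rcases eq_or_ne x 0 with rfl | hx
  · simp
  · have : ‖x‖ ≠ 0 := norm_ne_zero_iff.2 hx
    rw [norm_smul, norm_inv, norm_pow, norm_norm]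
    field_simp

/-- The change of variables formula for the inversion `x ↦ x / |x|²` in the unit sphere. -/
theorem integral_comp_inversion [FiniteDimensional ℝ E] [Nontrivial E] [MeasurableSpace E]
    [BorelSpace E] (μ : Measure E) [μ.IsAddHaarMeasure] (g : E → ℝ) :
    ∫ x, g x ∂μ =
      ∫ x, (‖x‖ ^ (2 * Module.finrank ℝ E))⁻¹ * g ((‖x‖ ^ 2)⁻¹ • x) ∂μ := by
  have hinv := EuclideanGeometry.inversion_involutive (0 : E) (one_ne_zero (α := ℝ))
  have himage : EuclideanGeometry.inversion (0 : E) 1 '' {0}ᶜ = {0}ᶜ := by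
    rw [Set.image_compl_eq hinv.bijective]
    simp
  have hderiv : ∀ x ∈ ({0}ᶜ : Set E), HasFDerivWithinAt (EuclideanGeometry.inversion (0 : E) 1)
      (((1 : ℝ) / dist x 0) ^ 2 • ((ℝ ∙ (x - 0))ᗮ.reflection : E →L[ℝ] E)) {0}ᶜ x :=
    fun x hx => (EuclideanGeometry.hasFDerivAt_inversion hx).hasFDerivWithinAt
  have hcov := integral_image_eq_integral_abs_det_fderiv_smul μ
    (measurableSet_singleton (0 : E)).compl hderiv hinv.injective.injOn g
  have hzero : ({0}ᶜ : Set E) =ᵐ[μ] Set.univ := by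
    simp [ae_eq_univ]
  rw [himage, setIntegral_congr_set hzero, setIntegral_congr_set hzero, setIntegral_univ,
    setIntegral_univ] at hcov
  rw [hcov]
  congr 1
  ext x
  have hdet : |(((ℝ ∙ (x - 0))ᗮ.reflection : E →L[ℝ] E)).det| = 1 := by
    have := (ℝ ∙ (x - 0))ᗮ.det_reflection
    simp only [ContinuousLinearMap.det]
    erw [this]
    simp
  have hsmul : ∀ (a : ℝ) (A : E →L[ℝ] E), (a • A).det = a ^ Module.finrank ℝ E * A.det := by
    intro a A
    simp [ContinuousLinearMap.det]
  rw [hsmul, abs_mul, hdet, inversion_zero_one_eq]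
  simp [pow_mul]

end Inversion

theorem bubble_smul_inversion (N : ℕ) (s c : ℝ) {lam : ℝ} (hlam : 0 < lam)
    {x : EuclideanSpace ℝ (Fin N)} (hx : x ≠ 0) :
    bubble N s c (lam • ((‖x‖ ^ 2)⁻¹ • x)) =
      lam ^ (-((N : ℝ) - 2 * s)) * ‖x‖ ^ ((N : ℝ) - 2 * s) * bubble N s c (lam⁻¹ • x) := by
  have hr : 0 < ‖x‖ := norm_pos_iff.2 hx
  have hbase : 1 / (1 + ‖lam • ((‖x‖ ^ 2)⁻¹ • x)‖ ^ 2) =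
      (lam⁻¹) ^ 2 * ‖x‖ ^ 2 * (1 / (1 + ‖lam⁻¹ • x‖ ^ 2)) := by
    rw [norm_smul, norm_inv_norm_sq_smul, norm_smul, norm_inv, Real.norm_of_nonneg hlam.le]
    field_simp
    ring
  have hsq : ∀ a : ℝ, 0 ≤ a → (a ^ 2) ^ (((N : ℝ) - 2 * s) / 2) = a ^ ((N : ℝ) - 2 * s) := by
    intro a ha
    rw [← Real.rpow_natCast, ← Real.rpow_mul ha]
    congr 1
    push_cast
    ring
  unfold bubble
  rw [hbase, Real.mul_rpow (by positivity) (by positivity),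
    Real.mul_rpow (by positivity) (by positivity), hsq _ (by positivity), hsq _ hr.le,
    Real.inv_rpow hlam.le, ← Real.rpow_neg hlam.le]
  ring

/-- If `h` satisfies the Kelvin relation `h(y) = |y|^{-(N+2s)} h(y/|y|²)` a.e. and is
suitably integrable, then `I(λ) = λ^{(N-2s)/2} ∫ U(λy) h(y) dy` satisfies `I(λ) = I(1/λ)`. -/
theorem kelvin_symmetry_of_dilation_pairing
    (N : ℕ) (hN : 3 ≤ N) (s : ℝ) (hs : s ∈ Set.Ioo (0 : ℝ) 1) (c : ℝ) (hc : 0 < c)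
    (h : EuclideanSpace ℝ (Fin N) → ℝ) (hmeas : Measurable h)
    (hkel : ∀ᵐ y : EuclideanSpace ℝ (Fin N), y ≠ 0 →
      h y = ‖y‖ ^ (-((N : ℝ) + 2 * s)) * h ((‖y‖ ^ 2)⁻¹ • y))
    (hint : (∫⁻ y : EuclideanSpace ℝ (Fin N),
      ENNReal.ofReal ((1 + ‖y‖) ^ (-((N : ℝ) - 2 * s)) * |h y|)) < ⊤) :
    ∀ lam : ℝ, 0 < lam →
      lam ^ (((N : ℝ) - 2 * s) / 2) *
          ∫ y : EuclideanSpace ℝ (Fin N), bubble N s c (lam • y) * h y =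
        lam ^ (-(((N : ℝ) - 2 * s) / 2)) *
          ∫ y : EuclideanSpace ℝ (Fin N), bubble N s c (lam⁻¹ • y) * h y := by
  intro lam hlam
  have : Nonempty (Fin N) := ⟨⟨0, by omega⟩⟩
  have hne : ∀ᵐ y : EuclideanSpace ℝ (Fin N), y ≠ 0 := Measure.ae_ne volume 0
  have hI : ∫ y : EuclideanSpace ℝ (Fin N), bubble N s c (lam • y) * h y =
      ∫ y : EuclideanSpace ℝ (Fin N),
        lam ^ (-((N : ℝ) - 2 * s)) * (bubble N s c (lam⁻¹ • y) * h y) := by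
    rw [integral_comp_inversion]
    apply integral_congr_ae
    filter_upwards [hkel, hne] with x hkx hx
    have hr : 0 < ‖x‖ := norm_pos_iff.2 hx
    have hpow : (‖x‖ ^ (2 * N))⁻¹ * ‖x‖ ^ ((N : ℝ) - 2 * s) = ‖x‖ ^ (-((N : ℝ) + 2 * s)) := by
      rw [← Real.rpow_natCast, ← Real.rpow_neg hr.le, ← Real.rpow_add hr]
      congr 1
      push_cast
      ring
    rw [bubble_smul_inversion N s c hlam hx, hkx hx, finrank_euclideanSpace_fin, ← hpow]
    ring
  rw [hI, integral_const_mul, ← mul_assoc, ← Real.rpow_add hlam]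
  congr 2
  ring

end
end

section
/- Suppose h : ℝ^N → ℝ is measurable, satisfies the Kelvin relation h(y) = |y|^{−(N+2s)} h(y/|y|²) for almost every y ≠ 0, and |h(y)| ≤ C₀ (1+|y|)^{−(N+2s)} for almost every y, for some constant C₀ > 0. Let v_{N+1}(y) = y·∇U(y) + ((N−2s)/2) U(y). Then ∫_{ℝ^N} h(y) v_{N+1}(y) dy = 0. -/
open MeasureTheory Real ENNReal

noncomputable section

/-- The dilation kernel element `v_{N+1}(y) = y·∇U(y) + ((N-2s)/2) U(y)`. -/
def vDil (N : ℕ) (s c : ℝ) (y : EuclideanSpace ℝ (Fin N)) : ℝ :=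
  fderiv ℝ (bubble N s c) y y + (((N : ℝ) - 2 * s) / 2) * bubble N s c y

/-- The explicit value of the dilation kernel element,
`v_{N+1}(y) = a c (1 - |y|²) (1/(1+|y|²))^{a+1}` with `a = (N-2s)/2`. -/
lemma vDil_eq (N : ℕ) (s c : ℝ) (y : EuclideanSpace ℝ (Fin N)) :
    vDil N s c y = (((N : ℝ) - 2 * s) / 2) * c * (1 - ‖y‖ ^ 2) *
      (1 / (1 + ‖y‖ ^ 2)) ^ (((N : ℝ) - 2 * s) / 2 + 1) := by
  set a : ℝ := ((N : ℝ) - 2 * s) / 2 with ha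
  have hpos : 0 < 1 + ‖y‖ ^ 2 := by positivity
  have hq : HasFDerivAt (fun z : EuclideanSpace ℝ (Fin N) => 1 + ‖z‖ ^ 2)
      (2 • innerSL ℝ y) y := (hasStrictFDerivAt_norm_sq y).hasFDerivAt.const_add 1
  have hpow : HasDerivAt (fun t : ℝ => c * (1 / t) ^ a)
      (c * (-a * (1 / (1 + ‖y‖ ^ 2)) ^ (a + 1))) (1 + ‖y‖ ^ 2) := by
    have hinv : HasDerivAt (fun t : ℝ => 1 / t) (-((1 + ‖y‖ ^ 2) ^ 2)⁻¹) (1 + ‖y‖ ^ 2) := by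
      simpa only [one_div] using hasDerivAt_inv hpos.ne'
    have hx : 0 < 1 / (1 + ‖y‖ ^ 2) := by positivity
    refine ((hinv.rpow_const (p := a) (Or.inl hx.ne')).const_mul c).congr_deriv ?_
    rw [show a + 1 = (a - 1) + 2 by ring, rpow_add hx (a - 1) 2, Real.rpow_two]
    field_simp
  have hU := hpow.comp_hasFDerivAt y hq
  rw [vDil, show fderiv ℝ (bubble N s c) y = _ from hU.fderiv]
  simp only [bubble, _root_.smul_apply, innerSL_apply_apply,
    real_inner_self_eq_norm_sq, smul_eq_mul, nsmul_eq_mul, ← ha]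
  rw [rpow_add_one (by positivity)]
  field_simp
  ring

/-- The dilation kernel element is odd under the Kelvin transform of weight `N - 2s`. -/
lemma vDil_inversion (N : ℕ) (s c : ℝ) {y : EuclideanSpace ℝ (Fin N)} (hy : y ≠ 0) :
    vDil N s c ((‖y‖ ^ 2)⁻¹ • y) = -(‖y‖ ^ ((N : ℝ) - 2 * s) * vDil N s c y) := by
  have hr : 0 < ‖y‖ := norm_pos_iff.mpr hy
  have hnorm : ‖(‖y‖ ^ 2)⁻¹ • y‖ = ‖y‖⁻¹ := by
    rw [norm_smul, norm_inv, norm_pow, norm_norm]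
    field_simp
  have hfrac : 1 / (1 + ‖y‖⁻¹ ^ 2) = ‖y‖ ^ 2 * (1 / (1 + ‖y‖ ^ 2)) := by
    field_simp
    ring
  have hpow : (‖y‖ ^ 2) ^ (((N : ℝ) - 2 * s) / 2 + 1) = ‖y‖ ^ ((N : ℝ) - 2 * s) * ‖y‖ ^ 2 := by
    rw [← Real.rpow_two, ← rpow_mul hr.le, ← rpow_add hr]
    ring_nf
  rw [vDil_eq, vDil_eq, hnorm, hfrac, mul_rpow (by positivity) (by positivity), hpow]
  field_simp
  ring

/-- Change of variables under inversion in the unit sphere. No integrability is required. -/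
lemma integral_eq_integral_inversion {E : Type*} [NormedAddCommGroup E] [InnerProductSpace ℝ E]
    [FiniteDimensional ℝ E] [Nontrivial E] [MeasurableSpace E] [BorelSpace E] (μ : Measure E)
    [μ.IsAddHaarMeasure] (f : E → ℝ) :
    ∫ y, f y ∂μ =
      ∫ y, (‖y‖⁻¹ ^ 2) ^ Module.finrank ℝ E * f ((‖y‖ ^ 2)⁻¹ • y) ∂μ := by
  have hinv (y : E) : EuclideanGeometry.inversion 0 1 y = (‖y‖ ^ 2)⁻¹ • y := by
    simp [EuclideanGeometry.inversion]
  have hae : ({0}ᶜ : Set E) =ᵐ[μ] Set.univ := by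
    rw [ae_eq_univ, compl_compl]
    exact measure_singleton 0
  have himage : EuclideanGeometry.inversion (0 : E) 1 '' {0}ᶜ = {0}ᶜ := by
    rw [Set.image_compl_eq (EuclideanGeometry.inversion_bijective 0 one_ne_zero),
      Set.image_singleton, EuclideanGeometry.inversion_self]
  have hdet {y : E} (hy : y ≠ 0) :
      |(((1 / dist y 0) ^ 2 • ((ℝ ∙ (y - 0))ᗮ.reflection : E →L[ℝ] E)).det)| =
        (‖y‖⁻¹ ^ 2) ^ Module.finrank ℝ E := by
    rw [ContinuousLinearMap.det, ContinuousLinearMap.toLinearMap_smul, LinearMap.det_smul, abs_mul]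
    have hrefl := Submodule.det_reflection ((ℝ ∙ (y - 0))ᗮ)
    erw [hrefl]
    simp
  have hcov := integral_image_eq_integral_abs_det_fderiv_smul μ
    (measurableSet_singleton (0 : E)).compl
    (fun y hy => (EuclideanGeometry.hasFDerivAt_inversion (R := 1) hy).hasFDerivWithinAt)
    (EuclideanGeometry.inversion_injective (0 : E) one_ne_zero).injOn f
  rw [himage, setIntegral_congr_set hae, setIntegral_univ] at hcov
  rw [hcov, ← setIntegral_univ (f := fun y => _ * _), ← setIntegral_congr_set hae]
  refine setIntegral_congr_fun (measurableSet_singleton 0).compl fun y hy => ?_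
  simp only [hdet hy, hinv, smul_eq_mul]

/-- If `h` satisfies the Kelvin relation a.e. and decays like `(1+|y|)^{-(N+2s)}`,
then `h` is orthogonal to the dilation kernel `v_{N+1}`. -/
theorem kelvin_invariant_orthogonal_to_dilation
    (N : ℕ) (hN : 3 ≤ N) (s : ℝ) (hs : s ∈ Set.Ioo (0 : ℝ) 1) (c : ℝ) (hc : 0 < c)
    (h : EuclideanSpace ℝ (Fin N) → ℝ) (hmeas : Measurable h)
    (hkel : ∀ᵐ y : EuclideanSpace ℝ (Fin N), y ≠ 0 →
      h y = ‖y‖ ^ (-((N : ℝ) + 2 * s)) * h ((‖y‖ ^ 2)⁻¹ • y))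
    (C₀ : ℝ) (hC₀ : 0 < C₀)
    (hdecay : ∀ᵐ y : EuclideanSpace ℝ (Fin N),
      |h y| ≤ C₀ * (1 + ‖y‖) ^ (-((N : ℝ) + 2 * s))) :
    (∫ y : EuclideanSpace ℝ (Fin N), h y * vDil N s c y) = 0 := by
  have : Nontrivial (EuclideanSpace ℝ (Fin N)) := by
    have : NeZero N := ⟨by lia⟩
    infer_instance
  have hodd : ∫ y, h y * vDil N s c y = ∫ y, -(h y * vDil N s c y) := by
    rw [integral_eq_integral_inversion]
    refine integral_congr_ae ?_
    filter_upwards [hkel, Measure.ae_ne volume 0] with y hy hy0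
    have hr : 0 < ‖y‖ := norm_pos_iff.mpr hy0
    have hexp : ((‖y‖⁻¹ ^ 2) ^ N : ℝ) * ‖y‖ ^ ((N : ℝ) - 2 * s) = ‖y‖ ^ (-((N : ℝ) + 2 * s)) := by
      rw [← pow_mul, ← Real.rpow_natCast, inv_rpow hr.le, ← rpow_neg hr.le, ← rpow_add hr]
      push_cast
      ring_nf
    rw [vDil_inversion N s c hy0, hy hy0, ← hexp, finrank_euclideanSpace_fin]
    ring
  rw [integral_neg] at hodd
  linarith

end
end
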